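/- Let n ≥ 5 with n ≡ 0 (mod 5), n ≡ 3 (mod 5), or n ≡ 4 (mod 5). Then the bondage number of P(n,2) satisfies 2 ≤ b(P(n,2)) ≤ 3; in particular, removing any single edge from P(n,2) leaves the domination number equal to ⌈3n/5⌉, while there is a set of 3 edges whose removal increases the domination number. -/

import Mathlib

namespace PetersenDom

/-- Vertex set of the generalized Petersen graph: `Sum.inl i` is the outer
vertex `u_i`, `Sum.inr i` is the inner vertex `v_i`, indices in `ZMod n`. -/
abbrev PVert (n : ℕ) := ZMod n ⊕ ZMod n

/-- The outer vertex `u_i`. -/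
def uV {n : ℕ} (i : ZMod n) : PVert n := Sum.inl i

/-- The inner vertex `v_i`. -/
def vV {n : ℕ} (i : ZMod n) : PVert n := Sum.inr i

/-- The generalized Petersen graph `P(n,2)`, with edges
`u_i u_{i+1}`, `u_i v_i`, `v_i v_{i+2}` (indices mod `n`). -/
def P2 (n : ℕ) : SimpleGraph (PVert n) :=
  SimpleGraph.fromRel (fun a b =>
    (∃ i : ZMod n, a = uV i ∧ b = uV (i + 1)) ∨
    (∃ i : ZMod n, a = uV i ∧ b = vV i) ∨
    (∃ i : ZMod n, a = vV i ∧ b = vV (i + 2)))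

/-- `S` is a dominating set of `G`: every vertex is in `S` or adjacent to a vertex of `S`. -/
def IsDomSet {V : Type*} (G : SimpleGraph V) (S : Set V) : Prop :=
  ∀ v : V, v ∈ S ∨ ∃ u ∈ S, G.Adj u v

/-- The domination number of `G`. -/
noncomputable def domNum {V : Type*} (G : SimpleGraph V) : ℕ :=
  sInf {k | ∃ S : Set V, IsDomSet G S ∧ S.ncard = k}

/-- `S` is a dominating set of `P_f(n,2) = P(n,2) - u_f`: it avoids `u_f`
and dominates every vertex other than `u_f`. -/
def IsDomSetF (n : ℕ) (f : ZMod n) (S : Set (PVert n)) : Prop :=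
  uV f ∉ S ∧ ∀ v : PVert n, v ≠ uV f → v ∈ S ∨ ∃ u ∈ S, (P2 n).Adj u v

/-- The domination number of `P_f(n,2)`. -/
noncomputable def domNumF (n : ℕ) (f : ZMod n) : ℕ :=
  sInf {k | ∃ S : Set (PVert n), IsDomSetF n f S ∧ S.ncard = k}

/-- `S` is a minimum dominating set of `P_f(n,2)`. -/
def MinDomF (n : ℕ) (f : ZMod n) (S : Set (PVert n)) : Prop :=
  IsDomSetF n f S ∧ S.ncard = domNumF n f

/-- The neighborhood `N(u_f) = {u_{f-1}, u_{f+1}, v_f}` of `u_f` in `P(n,2)`. -/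
def Nbr (n : ℕ) (f : ZMod n) : Set (PVert n) := {uV (f - 1), uV (f + 1), vV f}

/-- The block `B_i`: the 5 consecutive pairs of vertices centered at `u_i, v_i`. -/
def Blk (n : ℕ) (i : ZMod n) : Set (PVert n) :=
  {uV (i-2), uV (i-1), uV i, uV (i+1), uV (i+2),
   vV (i-2), vV (i-1), vV i, vV (i+1), vV (i+2)}

/-- `γ_i(S) = |B_i ∩ S|`. -/
noncomputable def gam (n : ℕ) (i : ZMod n) (S : Set (PVert n)) : ℕ :=
  (Blk n i ∩ S).ncard

/-- `L_i = {v_{i-1}, u_{i-2}, v_{i-2}}`. -/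
def Lset (n : ℕ) (i : ZMod n) : Set (PVert n) := {vV (i-1), uV (i-2), vV (i-2)}

/-- `R_i = {v_{i+1}, u_{i+2}, v_{i+2}}`. -/
def Rset (n : ℕ) (i : ZMod n) : Set (PVert n) := {vV (i+1), uV (i+2), vV (i+2)}

/-- `M_i = {u_{i-1}, v_i, u_{i+1}}`. -/
def Mset (n : ℕ) (i : ZMod n) : Set (PVert n) := {uV (i-1), vV i, uV (i+1)}

/-- `F = {f-2, f-1, f, f+1, f+2}`, the indices of the block `B_f`. -/
def Fset (n : ℕ) (f : ZMod n) : Set (ZMod n) := {f-2, f-1, f, f+1, f+2}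

/-- A Type I set: a minimum dominating set `S` of `P_f(n,2)` with
`γ_i(S) ≥ 2` for all `i`. -/
def TypeI (n : ℕ) (f : ZMod n) (S : Set (PVert n)) : Prop :=
  MinDomF n f S ∧ ∀ i : ZMod n, 2 ≤ gam n i S

/-- The couple number of `S`: the number of indices `i ∉ F` with `γ_i(S) = 2`. -/
noncomputable def coupleNum (n : ℕ) (f : ZMod n) (S : Set (PVert n)) : ℕ :=
  {i : ZMod n | gam n i S = 2 ∧ i ∉ Fset n f}.ncard

/-- A Type II set: a Type I set with `N(u_f) ∩ S = ∅`, `γ_f(S) = 3`, and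
`B_f ∩ S = {u_{f-2}, v_{f+1}, v_{f+2}}`. -/
def TypeII (n : ℕ) (f : ZMod n) (S : Set (PVert n)) : Prop :=
  TypeI n f S ∧ Nbr n f ∩ S = ∅ ∧ gam n f S = 3 ∧
    Blk n f ∩ S = {uV (f-2), vV (f+1), vV (f+2)}

/-- A Type III set: a Type I set with `N(u_f) ∩ S = ∅`, `γ_f(S) = 4`, and
`B_f ∩ S` one of four specified patterns. -/
def TypeIII (n : ℕ) (f : ZMod n) (S : Set (PVert n)) : Prop :=
  TypeI n f S ∧ Nbr n f ∩ S = ∅ ∧ gam n f S = 4 ∧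
    (Blk n f ∩ S = {vV (f-1), vV (f+1), uV (f+2), vV (f+2)} ∨
     Blk n f ∩ S = {uV (f-2), vV (f-2), uV (f+2), vV (f+2)} ∨
     Blk n f ∩ S = {vV (f-2), vV (f-1), vV (f+1), vV (f+2)} ∨
     Blk n f ∩ S = {uV (f-2), vV (f-2), vV (f+1), uV (f+2)})

/-- `⌈3n/5⌉`. -/
noncomputable def ceil35 (n : ℕ) : ℕ := ⌈(3 * (n : ℚ)) / 5⌉₊

/-- The bondage number of `G`: the least number of edges whose deletion
increases the domination number. -/
noncomputable def bondage {V : Type*} (G : SimpleGraph V) : ℕ :=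
  sInf {k | ∃ E : Set (Sym2 V), E ⊆ G.edgeSet ∧ E.ncard = k ∧
    domNum G < domNum (G.deleteEdges E)}

/-- The domination alteration number of `G`: the least number of vertices
whose removal changes the domination number. -/
noncomputable def alterNum {V : Type*} (G : SimpleGraph V) : ℕ :=
  sInf {k | ∃ A : Set V, A.ncard = k ∧ domNum (G.induce Aᶜ) ≠ domNum G}

end PetersenDom
namespace PetersenDom

open Finset

lemma P2_adj_iff {n : ℕ} (hn : 5 ≤ n) {x y : PVert n} : (P2 n).Adj x y ↔
    (∃ i : ZMod n, x = uV i ∧ y = uV (i + 1) ∨ x = uV (i + 1) ∧ y = uV i) ∨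
    (∃ i : ZMod n, x = uV i ∧ y = vV i ∨ x = vV i ∧ y = uV i) ∨
    (∃ i : ZMod n, x = vV i ∧ y = vV (i + 2) ∨ x = vV (i + 2) ∧ y = vV i) := by
  have h1 : (1 : ZMod n) ≠ 0 := by
    have := (ZMod.natCast_eq_zero_iff 1 n).not.2 (Nat.not_dvd_of_pos_of_lt one_pos (by lia))
    exact_mod_cast this
  have h2 : (2 : ZMod n) ≠ 0 := by
    have := (ZMod.natCast_eq_zero_iff 2 n).not.2 (Nat.not_dvd_of_pos_of_lt two_pos (by lia))
    exact_mod_cast this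
  rw [P2, SimpleGraph.fromRel_adj]
  constructor
  · rintro ⟨-, (⟨i, h⟩ | ⟨i, h⟩ | ⟨i, h⟩) | (⟨i, h⟩ | ⟨i, h⟩ | ⟨i, h⟩)⟩
    exacts [.inl ⟨i, .inl h⟩, .inr (.inl ⟨i, .inl h⟩), .inr (.inr ⟨i, .inl h⟩),
      .inl ⟨i, .inr h.symm⟩, .inr (.inl ⟨i, .inr h.symm⟩), .inr (.inr ⟨i, .inr h.symm⟩)]
  · rintro (⟨i, ⟨rfl, rfl⟩ | ⟨rfl, rfl⟩⟩ | ⟨i, ⟨rfl, rfl⟩ | ⟨rfl, rfl⟩⟩ |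
      ⟨i, ⟨rfl, rfl⟩ | ⟨rfl, rfl⟩⟩) <;> simp [uV, vV, h1, h2]

/-- The neighbors of an outer vertex. -/
lemma adj_uV {n : ℕ} (hn : 5 ≤ n) {x : PVert n} {i : ZMod n} (h : (P2 n).Adj x (uV i)) :
    x = uV (i - 1) ∨ x = uV (i + 1) ∨ x = vV i := by
  rw [P2_adj_iff hn] at h
  rcases h with ⟨j, ⟨rfl, h⟩ | ⟨rfl, h⟩⟩ | ⟨j, ⟨rfl, h⟩ | ⟨rfl, h⟩⟩ | ⟨j, ⟨rfl, h⟩ | ⟨rfl, h⟩⟩ <;>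
    simp_all [uV, vV]

/-- The neighbors of an inner vertex. -/
lemma adj_vV {n : ℕ} (hn : 5 ≤ n) {x : PVert n} {i : ZMod n} (h : (P2 n).Adj x (vV i)) :
    x = vV (i - 2) ∨ x = vV (i + 2) ∨ x = uV i := by
  rw [P2_adj_iff hn] at h
  rcases h with ⟨j, ⟨rfl, h⟩ | ⟨rfl, h⟩⟩ | ⟨j, ⟨rfl, h⟩ | ⟨rfl, h⟩⟩ | ⟨j, ⟨rfl, h⟩ | ⟨rfl, h⟩⟩ <;>
    simp_all [uV, vV]

/-! ### Domination numbers -/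

lemma domNum_le {V : Type*} {G : SimpleGraph V} {S : Set V} (h : IsDomSet G S) :
    domNum G ≤ S.ncard :=
  Nat.sInf_le ⟨S, h, rfl⟩

lemma exists_isDomSet_ncard {V : Type*} (G : SimpleGraph V) :
    ∃ S : Set V, IsDomSet G S ∧ S.ncard = domNum G :=
  Nat.sInf_mem (s := {k | ∃ S : Set V, IsDomSet G S ∧ S.ncard = k})
    ⟨_, Set.univ, fun v => .inl (Set.mem_univ v), rfl⟩

lemma IsDomSet.of_deleteEdges {V : Type*} {G : SimpleGraph V} {E : Set (Sym2 V)} {S : Set V}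
    (h : IsDomSet (G.deleteEdges E) S) : IsDomSet G S := fun v =>
  (h v).imp_right fun ⟨u, hu, huv⟩ => ⟨u, hu, (SimpleGraph.deleteEdges_adj.1 huv).1⟩

/-- Deleting an edge whose ends are both inside or both outside a dominating set is harmless. -/
lemma IsDomSet.deleteEdges_singleton {V : Type*} {G : SimpleGraph V} {S : Set V} {x y : V}
    (h : IsDomSet G S) (hxy : x ∈ S ↔ y ∈ S) : IsDomSet (G.deleteEdges {s(x, y)}) S := by
  intro v
  by_cases hv : v ∈ S
  · exact .inl hv
  obtain ⟨u, hu, huv⟩ := (h v).resolve_left hv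
  refine .inr ⟨u, hu, SimpleGraph.deleteEdges_adj.2 ⟨huv, fun he => ?_⟩⟩
  rcases Sym2.eq_iff.1 (Set.mem_singleton_iff.1 he) with ⟨rfl, rfl⟩ | ⟨rfl, rfl⟩ <;> tauto

open Classical in
lemma ncard_eq_sum {n : ℕ} [NeZero n] (S : Set (PVert n)) :
    S.ncard = ∑ i : ZMod n, ((decide (uV i ∈ S)).toNat + (decide (vV i ∈ S)).toNat) := by
  rw [Set.ncard_eq_toFinset_card', Set.toFinset_card, Fintype.card_subtype, card_filter,
    Fintype.sum_sum_type, sum_add_distrib]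
  congr 1 <;> refine sum_congr rfl fun i _ => ?_ <;> split_ifs with h <;> simp [uV, vV, h]

/-! ### Lower bounds -/

/-- The entry of a table, stored as the base-16 digits of `T`, belonging to
four consecutive columns of a set. -/
def tableEntry (T : ℕ) (a₀ b₀ a₁ b₁ a₂ b₂ a₃ b₃ : Bool) : ℕ :=
  (T >>> (4 * (a₀.toNat + 2 * b₀.toNat + 4 * a₁.toNat + 8 * b₁.toNat + 16 * a₂.toNat +
    32 * b₂.toNat + 64 * a₃.toNat + 128 * b₃.toNat))) % 16

/-- A potential for sets whose defect is centred at a column followed by an absent outer vertex. -/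
def tableAbsent : ℕ :=
  143815450788985272618344415263121978689438158315384525818744064926079452413400171969351070200387253514520816949149257749516124297509555316264873243648560194597532520085738145173454284978201557510059494720507608946884764888503712508172380930300092720594945663125792508909416726719731562614701807198977160002572

/-- A potential for sets whose defect is centred at a column followed by a present outer vertex. -/
def tablePresent : ℕ :=
  119846208990821060515287012719268315574531798596153771515620054105155117197233673780644847054347568851717020961102457236063813986353055857764496051183664019993198200647694217719479664146649490094749861471002367152727125063510790449496957293109736719612060300919672382587005756191907488429740610759234571737610

/-- One step of the potential argument, for the column `a₂, b₂` whose outer vertex is dominated;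
`r` says which columns may leave their inner vertex undominated. -/
def TableStep (T : ℕ) (r : Bool) : Prop :=
  ∀ a₀ b₀ a₁ b₁ a₂ b₂ a₃ b₃ a₄ b₄ : Bool, (a₂ || a₁ || a₃ || b₂) = true →
    ((b₂ || b₀ || b₄ || a₂) = true →
      tableEntry T a₁ b₁ a₂ b₂ a₃ b₃ a₄ b₄ + 3 ≤
        tableEntry T a₀ b₀ a₁ b₁ a₂ b₂ a₃ b₃ + 5 * (a₄.toNat + b₄.toNat)) ∧
    (b₂ = false → a₃ = r →
      tableEntry T a₁ b₁ a₂ b₂ a₃ b₃ a₄ b₄ + 3 ≤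
        tableEntry T a₀ b₀ a₁ b₁ a₂ b₂ a₃ b₃ + 5 * (a₄.toNat + b₄.toNat) + 1)

lemma tableStep_absent : TableStep tableAbsent false := by
  unfold TableStep
  decide +kernel

lemma tableStep_present : TableStep tablePresent true := by
  unfold TableStep
  decide +kernel

/-- Summing a potential inequality around a cycle. -/
lemma three_mul_le_of_potential {n : ℕ} [NeZero n] (s c d : ZMod n → ℕ)
    (h : ∀ i, s (i + 1) + 3 ≤ s i + 5 * c (i + 2) + d i) :
    3 * n ≤ 5 * ∑ i, c i + ∑ i, d i := by
  have hsum := sum_le_sum fun i (_ : i ∈ (univ : Finset (ZMod n))) => h i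
  have hs : ∑ i, s (i + 1) = ∑ i, s i := Equiv.sum_comp (Equiv.addRight (1 : ZMod n)) s
  have hc : ∑ i, c (i + 2) = ∑ i, c i := Equiv.sum_comp (Equiv.addRight (2 : ZMod n)) c
  simp only [sum_add_distrib, ← mul_sum, hs, hc, sum_const, card_univ, ZMod.card,
    smul_eq_mul] at hsum
  lia

lemma TableStep.three_mul_le {T : ℕ} {r : Bool} (hT : TableStep T r) {n : ℕ} [NeZero n]
    (A B : ZMod n → Bool) (d : ZMod n → ℕ)
    (hu : ∀ i, (A i || A (i - 1) || A (i + 1) || B i) = true)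
    (hv : ∀ i, (B i || B (i - 2) || B (i + 2) || A i) = true ∨
      B i = false ∧ A (i + 1) = r ∧ d i = 1) :
    3 * n ≤ 5 * ∑ i, ((A i).toNat + (B i).toNat) + ∑ i, d i := by
  refine three_mul_le_of_potential
    (fun i => tableEntry T (A (i - 2)) (B (i - 2)) (A (i - 1)) (B (i - 1)) (A i) (B i)
      (A (i + 1)) (B (i + 1))) (fun i => (A i).toNat + (B i).toNat) d fun i => ?_
  have e1 : i + 1 - 2 = i - 1 := by ring
  have e2 : i + 1 - 1 = i := by ring
  have e3 : i + 1 + 1 = i + 2 := by ring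
  simp only [e1, e2, e3]
  obtain ⟨h0, h1⟩ := hT (A (i - 2)) (B (i - 2)) (A (i - 1)) (B (i - 1)) (A i) (B i)
    (A (i + 1)) (B (i + 1)) (A (i + 2)) (B (i + 2)) (hu i)
  rcases hv i with h | ⟨hb, ha, hd⟩
  · exact (h0 h).trans (Nat.le_add_right _ _)
  · rw [hd]
    exact h1 hb ha

/-- A dominating set of `P(n,2)` has at least `3n/5` elements. -/
lemma IsDomSet.three_mul_le {n : ℕ} (hn : 5 ≤ n) {S : Set (PVert n)} (hS : IsDomSet (P2 n) S) :
    3 * n ≤ 5 * S.ncard := by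
  classical
  have : NeZero n := ⟨by lia⟩
  rw [ncard_eq_sum]
  refine (tableStep_present.three_mul_le (fun i => decide (uV i ∈ S))
    (fun i => decide (vV i ∈ S)) 0 (fun i => ?_) fun i => .inl ?_).trans (by simp)
  · simp only [Bool.or_eq_true, decide_eq_true_eq]
    rcases hS (uV i) with h | ⟨u, hu, h⟩
    · tauto
    · rcases adj_uV hn h with rfl | rfl | rfl <;> tauto
  · simp only [Bool.or_eq_true, decide_eq_true_eq]
    rcases hS (vV i) with h | ⟨u, hu, h⟩
    · tauto
    · rcases adj_vV hn h with rfl | rfl | rfl <;> tauto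

/-- The three edges at the inner vertex `v_0`. -/
def innerStar (n : ℕ) : Set (Sym2 (PVert n)) :=
  {s(vV 0, uV 0), s(vV 0, vV 2), s(vV 0, vV (-2))}

lemma innerStar_subset {n : ℕ} (hn : 5 ≤ n) : innerStar n ⊆ (P2 n).edgeSet := by
  rintro e (rfl | rfl | rfl) <;> rw [SimpleGraph.mem_edgeSet, P2_adj_iff hn]
  · exact .inr (.inl ⟨0, .inr ⟨rfl, rfl⟩⟩)
  · exact .inr (.inr ⟨0, .inl ⟨rfl, by rw [zero_add]⟩⟩)
  · exact .inr (.inr ⟨-2, .inr ⟨by rw [neg_add_cancel], rfl⟩⟩)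

lemma ncard_innerStar {n : ℕ} (hn : 5 ≤ n) : (innerStar n).ncard = 3 := by
  have h4 : (4 : ZMod n) ≠ 0 := by
    have := (ZMod.natCast_eq_zero_iff 4 n).not.2 (Nat.not_dvd_of_pos_of_lt four_pos (by lia))
    exact_mod_cast this
  have h : (2 : ZMod n) ≠ -2 := fun h => h4 (by linear_combination h)
  have h2 : (2 : ZMod n) ≠ 0 := fun h0 => h (by rw [h0, neg_zero])
  exact Set.ncard_eq_three.2 ⟨_, _, _, by simp [uV, vV], by simp [uV, vV],
    by simp [vV, h, h2], rfl⟩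

lemma mem_innerStar_of_adj {n : ℕ} (hn : 5 ≤ n) {x : PVert n} (h : (P2 n).Adj x (vV 0)) :
    s(x, vV 0) ∈ innerStar n := by
  rw [Sym2.eq_swap]
  rcases adj_vV hn h with rfl | rfl | rfl <;> simp [innerStar]

/-- Isolating `v_0` raises the lower bound on dominating sets. -/
lemma IsDomSet.lt_of_innerStar {n : ℕ} (hn : 5 ≤ n) {S : Set (PVert n)}
    (hS : IsDomSet ((P2 n).deleteEdges (innerStar n)) S) : 3 * n + 4 ≤ 5 * S.ncard := by
  classical
  have : NeZero n := ⟨by lia⟩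
  have hadj {x y : PVert n} (h : ((P2 n).deleteEdges (innerStar n)).Adj x y) :
      (P2 n).Adj x y ∧ x ≠ vV 0 ∧ y ≠ vV 0 := by
    obtain ⟨h, he⟩ := SimpleGraph.deleteEdges_adj.1 h
    refine ⟨h, ?_, ?_⟩ <;> rintro rfl
    · exact he (Sym2.eq_swap ▸ mem_innerStar_of_adj hn h.symm)
    · exact he (mem_innerStar_of_adj hn h)
  have h0 : vV 0 ∈ S := (hS (vV 0)).resolve_right fun ⟨u, _, h⟩ => (hadj h).2.2 rfl
  have hcard := Set.ncard_sdiff_singleton_add_one h0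
  obtain ⟨S', hS'⟩ : ∃ S', S' = S \ {vV 0} := ⟨_, rfl⟩
  rw [← hS'] at hcard
  have hdom (y : PVert n) (hy : y ≠ vV 0) : y ∈ S' ∨ ∃ x ∈ S', (P2 n).Adj x y := by
    rcases hS y with h | ⟨x, hx, h⟩
    · exact .inl (hS' ▸ ⟨h, hy⟩)
    · exact .inr ⟨x, hS' ▸ ⟨hx, (hadj h).2.1⟩, (hadj h).1⟩
  have h0' : vV 0 ∉ S' := fun h => (hS' ▸ h).2 rfl
  have key : 3 * n ≤ 5 * S'.ncard + ∑ i : ZMod n, (if i = 0 then 1 else 0) := by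
    have hu (i : ZMod n) : (decide (uV i ∈ S') || decide (uV (i - 1) ∈ S') ||
        decide (uV (i + 1) ∈ S') || decide (vV i ∈ S')) = true := by
      simp only [Bool.or_eq_true, decide_eq_true_eq]
      rcases hdom (uV i) (by simp [uV, vV]) with h | ⟨u, hu, h⟩
      · tauto
      · rcases adj_uV hn h with rfl | rfl | rfl <;> tauto
    have hv (i : ZMod n) : (decide (vV i ∈ S') || decide (vV (i - 2) ∈ S') ||
        decide (vV (i + 2) ∈ S') || decide (uV i ∈ S')) = true ∨ decide (vV i ∈ S') = false ∧
        decide (uV (i + 1) ∈ S') = decide (uV (1 : ZMod n) ∈ S') ∧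
          (if i = 0 then 1 else 0) = 1 := by
      by_cases hi : i = 0
      · subst hi
        exact .inr ⟨decide_eq_false h0', by rw [zero_add], if_pos rfl⟩
      refine .inl ?_
      simp only [Bool.or_eq_true, decide_eq_true_eq]
      rcases hdom (vV i) (by simpa [vV] using hi) with h | ⟨u, hu, h⟩
      · tauto
      · rcases adj_vV hn h with rfl | rfl | rfl <;> tauto
    rw [ncard_eq_sum]
    cases hr : decide (uV (1 : ZMod n) ∈ S') <;> rw [hr] at hv
    · exact tableStep_absent.three_mul_le _ _ _ hu hv
    · exact tableStep_present.three_mul_le _ _ _ hu hv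
  rw [sum_ite_eq' univ (0 : ZMod n), if_pos (mem_univ _)] at key
  lia

/-! ### A periodic dominating set -/

/-- The set of all `u_{t+j}` with `j ≡ 1, 3` and all `v_{t+j}` with `j ≡ 2` modulo `5`,
where `0 ≤ j < n`. -/
def periodicSet (n : ℕ) (t : ZMod n) : Set (PVert n) :=
  {x | Sum.elim (fun i => (i - t).val % 5 = 1 ∨ (i - t).val % 5 = 3)
    (fun i => (i - t).val % 5 = 2) x}

lemma uV_mem_periodicSet {n : ℕ} {t i : ZMod n} : uV i ∈ periodicSet n t ↔
    (i - t).val % 5 = 1 ∨ (i - t).val % 5 = 3 := Iff.rfl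

lemma vV_mem_periodicSet {n : ℕ} {t i : ZMod n} : vV i ∈ periodicSet n t ↔
    (i - t).val % 5 = 2 := Iff.rfl

lemma isDomSet_periodicSet {n : ℕ} (hn : 5 ≤ n)
    (hmod : n % 5 = 0 ∨ n % 5 = 3 ∨ n % 5 = 4) (t : ZMod n) :
    IsDomSet (P2 n) (periodicSet n t) := by
  have : NeZero n := ⟨by lia⟩
  have val_add (i : ZMod n) (k : ℕ) (hk : (i - t).val + k < n) :
      (i + k - t).val = (i - t).val + k := by
    have : i + k - t = (((i - t).val + k : ℕ) : ZMod n) := by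
      rw [Nat.cast_add, ZMod.natCast_zmod_val]; ring
    rw [this, ZMod.val_natCast_of_lt hk]
  have val_sub (i : ZMod n) (k : ℕ) (hk : k ≤ (i - t).val) :
      (i - k - t).val = (i - t).val - k := by
    have : i - k - t = (((i - t).val - k : ℕ) : ZMod n) := by
      rw [Nat.cast_sub hk, ZMod.natCast_zmod_val]; ring
    rw [this, ZMod.val_natCast_of_lt (by have := ZMod.val_lt (i - t); lia)]
  rintro (i | i)
  · change uV i ∈ _ ∨ ∃ u ∈ _, (P2 n).Adj u (uV i)
    have hlt := ZMod.val_lt (i - t)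
    have hj : (i - t).val % 5 < 5 := Nat.mod_lt _ (by norm_num)
    by_cases h1 : uV i ∈ periodicSet n t
    · exact .inl h1
    rw [uV_mem_periodicSet] at h1
    obtain h | h | h : (i - t).val % 5 = 0 ∨ (i - t).val % 5 = 2 ∨ (i - t).val % 5 = 4 := by lia
    · refine .inr ⟨uV (i + (1 : ℕ)), ?_, ?_⟩
      · rw [uV_mem_periodicSet, val_add _ _ (by lia)]; lia
      · rw [Nat.cast_one]
        exact (P2_adj_iff hn).2 (.inl ⟨i, .inr ⟨rfl, rfl⟩⟩)
    · exact .inr ⟨vV i, h, (P2_adj_iff hn).2 (.inr (.inl ⟨i, .inr ⟨rfl, rfl⟩⟩))⟩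
    · refine .inr ⟨uV (i - (1 : ℕ)), ?_, ?_⟩
      · rw [uV_mem_periodicSet, val_sub _ _ (by lia)]; lia
      · rw [Nat.cast_one]
        exact (P2_adj_iff hn).2 (.inl ⟨i - 1, .inl ⟨rfl, by rw [sub_add_cancel]⟩⟩)
  · change vV i ∈ _ ∨ ∃ u ∈ _, (P2 n).Adj u (vV i)
    have hlt := ZMod.val_lt (i - t)
    have hj : (i - t).val % 5 < 5 := Nat.mod_lt _ (by norm_num)
    by_cases h1 : vV i ∈ periodicSet n t
    · exact .inl h1
    rw [vV_mem_periodicSet] at h1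
    obtain h | h | h : (i - t).val % 5 = 0 ∨ ((i - t).val % 5 = 1 ∨ (i - t).val % 5 = 3) ∨
      (i - t).val % 5 = 4 := by lia
    · refine .inr ⟨vV (i + (2 : ℕ)), ?_, ?_⟩
      · rw [vV_mem_periodicSet, val_add _ _ (by lia)]; lia
      · rw [Nat.cast_ofNat]
        exact (P2_adj_iff hn).2 (.inr (.inr ⟨i, .inr ⟨rfl, rfl⟩⟩))
    · exact .inr ⟨uV i, h, (P2_adj_iff hn).2 (.inr (.inl ⟨i, .inl ⟨rfl, rfl⟩⟩))⟩
    · refine .inr ⟨vV (i - (2 : ℕ)), ?_, ?_⟩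
      · rw [vV_mem_periodicSet, val_sub _ _ (by lia)]; lia
      · rw [Nat.cast_ofNat]
        exact (P2_adj_iff hn).2 (.inr (.inr ⟨i - 2, .inl ⟨rfl, by rw [sub_add_cancel]⟩⟩))

lemma sum_zmod_val {n : ℕ} [NeZero n] (f : ℕ → ℕ) :
    ∑ i : ZMod n, f i.val = ∑ j ∈ range n, f j := by
  obtain _ | n := n
  · exact absurd rfl (NeZero.ne 0)
  · exact Fin.sum_univ_eq_sum_range f (n + 1)

lemma ncard_periodicSet {n : ℕ} [NeZero n] (t : ZMod n) :
    (periodicSet n t).ncard = ∑ j ∈ range n,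
      ((decide (j % 5 = 1 ∨ j % 5 = 3)).toNat + (decide (j % 5 = 2)).toNat) := by
  classical
  rw [ncard_eq_sum, ← sum_zmod_val fun j =>
    (decide (j % 5 = 1 ∨ j % 5 = 3)).toNat + (decide (j % 5 = 2)).toNat]
  simp only [uV_mem_periodicSet, vV_mem_periodicSet]
  exact Equiv.sum_comp (Equiv.subRight t) fun i : ZMod n =>
    (decide (i.val % 5 = 1 ∨ i.val % 5 = 3)).toNat + (decide (i.val % 5 = 2)).toNat

lemma five_mul_ncard_periodicSet_le {n : ℕ} [NeZero n]
    (hmod : n % 5 = 0 ∨ n % 5 = 3 ∨ n % 5 = 4) (t : ZMod n) :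
    5 * (periodicSet n t).ncard ≤ 3 * n + 3 := by
  have hsum (k : ℕ) : ∑ j ∈ range (5 * k),
      ((decide (j % 5 = 1 ∨ j % 5 = 3)).toNat + (decide (j % 5 = 2)).toNat) = 3 * k := by
    induction k with
    | zero => rfl
    | succ k ih =>
      rw [show 5 * (k + 1) = 5 * k + 1 + 1 + 1 + 1 + 1 by ring]
      simp only [sum_range_succ, ih]
      simp [Nat.add_mod]
      ring
  rw [ncard_periodicSet]
  obtain h | h | h : n = 5 * (n / 5) ∨ n = 5 * (n / 5) + 1 + 1 + 1 ∨
      n = 5 * (n / 5) + 1 + 1 + 1 + 1 := by lia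
  all_goals
    rw [h]
    simp only [sum_range_succ, hsum]
    simp [Nat.add_mod]
    try lia

/-- Every edge of `P(n,2)` is redundant for some rotation of the periodic set. -/
lemma exists_isDomSet_deleteEdges {n : ℕ} (hn : 5 ≤ n)
    (hmod : n % 5 = 0 ∨ n % 5 = 3 ∨ n % 5 = 4) {e : Sym2 (PVert n)} (he : e ∈ (P2 n).edgeSet) :
    ∃ S, IsDomSet ((P2 n).deleteEdges {e}) S ∧ 5 * S.ncard ≤ 3 * n + 3 := by
  have : NeZero n := ⟨by lia⟩
  have red (t : ZMod n) {x y : PVert n} (hxy : x ∈ periodicSet n t ↔ y ∈ periodicSet n t) :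
      ∃ S, IsDomSet ((P2 n).deleteEdges {s(x, y)}) S ∧ 5 * S.ncard ≤ 3 * n + 3 :=
    ⟨_, (isDomSet_periodicSet hn hmod t).deleteEdges_singleton hxy,
      five_mul_ncard_periodicSet_le hmod t⟩
  have val_mod (k m : ℕ) (i j : ZMod n) (h : i - j = k) (hk : k % n % 5 = m) :
      (i - j).val % 5 = m := by
    rw [h, ZMod.val_natCast, hk]
  have h5 : 5 % n % 5 = 0 := by
    obtain rfl | h : n = 5 ∨ 5 < n := by lia
    · rfl
    · rw [Nat.mod_eq_of_lt h]
  have outer (i : ZMod n) : uV i ∈ periodicSet n (i - 4) ↔ uV (i + 1) ∈ periodicSet n (i - 4) := by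
    rw [uV_mem_periodicSet, uV_mem_periodicSet,
      val_mod 4 4 i (i - 4) (by push_cast; ring)
        (by rw [Nat.mod_eq_of_lt (by lia : 4 < n)]),
      val_mod 5 0 (i + 1) (i - 4) (by push_cast; ring) h5]
    decide
  have spoke (i : ZMod n) : uV i ∈ periodicSet n i ↔ vV i ∈ periodicSet n i := by
    rw [uV_mem_periodicSet, vV_mem_periodicSet, val_mod 0 0 i i (by simp) (by simp)]
    decide
  have inner (i : ZMod n) : vV i ∈ periodicSet n (i - 1) ↔ vV (i + 2) ∈ periodicSet n (i - 1) := by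
    rw [vV_mem_periodicSet, vV_mem_periodicSet,
      val_mod 1 1 i (i - 1) (by push_cast; ring)
        (by rw [Nat.mod_eq_of_lt (by lia : 1 < n)]),
      val_mod 3 3 (i + 2) (i - 1) (by push_cast; ring)
        (by rw [Nat.mod_eq_of_lt (by lia : 3 < n)])]
    decide
  induction e with | h x y =>
  rcases (P2_adj_iff hn).1 ((P2 n).mem_edgeSet.1 he) with ⟨i, ⟨rfl, rfl⟩ | ⟨rfl, rfl⟩⟩ |
    ⟨i, ⟨rfl, rfl⟩ | ⟨rfl, rfl⟩⟩ | ⟨i, ⟨rfl, rfl⟩ | ⟨rfl, rfl⟩⟩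
  exacts [red _ (outer i), red _ (outer i).symm, red _ (spoke i), red _ (spoke i).symm,
    red _ (inner i), red _ (inner i).symm]

lemma ceil35_eq {n m : ℕ} (h1 : 3 * n ≤ 5 * m) (h2 : 5 * m ≤ 3 * n + 3) : m = ceil35 n := by
  have h1' : (3 * n : ℚ) ≤ 5 * m := by exact_mod_cast h1
  have h2' : (5 * m : ℚ) ≤ 3 * n + 3 := by exact_mod_cast h2
  refine le_antisymm ?_ (Nat.ceil_le.2 (by linarith))
  refine Nat.le_of_lt_succ ?_
  have h := Nat.le_ceil ((3 * (n : ℚ)) / 5)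
  have : (m : ℚ) < ceil35 n + 1 := by rw [ceil35]; linarith
  exact_mod_cast this

/-- for `n ≡ 0, 3, 4 (mod 5)`, the bondage number of `P(n,2)`
satisfies `2 ≤ b(P(n,2)) ≤ 3`; removing any single edge leaves the domination
number equal to `⌈3n/5⌉`, while some 3 edges' removal increases it. -/
theorem bondage_bounds (n : ℕ) (hn : 5 ≤ n)
    (hmod : n % 5 = 0 ∨ n % 5 = 3 ∨ n % 5 = 4) :
    2 ≤ bondage (P2 n) ∧ bondage (P2 n) ≤ 3 ∧
    (∀ e ∈ (P2 n).edgeSet, domNum ((P2 n).deleteEdges {e}) = ceil35 n) ∧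
    (∃ E : Set (Sym2 (PVert n)), E ⊆ (P2 n).edgeSet ∧ E.ncard = 3 ∧
      domNum (P2 n) < domNum ((P2 n).deleteEdges E)) := by
  have : NeZero n := ⟨by lia⟩
  have hlow : 3 * n ≤ 5 * domNum (P2 n) := by
    obtain ⟨S, hS, hcard⟩ := exists_isDomSet_ncard (P2 n)
    exact hcard ▸ hS.three_mul_le hn
  have hup : 5 * domNum (P2 n) ≤ 3 * n + 3 :=
    (Nat.mul_le_mul_left 5 (domNum_le (isDomSet_periodicSet hn hmod 0))).trans
      (five_mul_ncard_periodicSet_le hmod 0)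
  have hdel : ∀ e ∈ (P2 n).edgeSet, domNum ((P2 n).deleteEdges {e}) = ceil35 n := by
    intro e he
    obtain ⟨S, hS, hcard⟩ := exists_isDomSet_ncard ((P2 n).deleteEdges {e})
    obtain ⟨S', hS', hcard'⟩ := exists_isDomSet_deleteEdges hn hmod he
    have hle := domNum_le hS'
    have hge := hS.of_deleteEdges.three_mul_le hn
    exact ceil35_eq (hcard ▸ hge) (by lia)
  have hstar : domNum (P2 n) < domNum ((P2 n).deleteEdges (innerStar n)) := by
    obtain ⟨S, hS, hcard⟩ := exists_isDomSet_ncard ((P2 n).deleteEdges (innerStar n))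
    have := hS.lt_of_innerStar hn
    lia
  have hthree : ∃ E : Set (Sym2 (PVert n)), E ⊆ (P2 n).edgeSet ∧ E.ncard = 3 ∧
      domNum (P2 n) < domNum ((P2 n).deleteEdges E) :=
    ⟨innerStar n, innerStar_subset hn, ncard_innerStar hn, hstar⟩
  refine ⟨le_csInf ⟨3, hthree⟩ ?_, Nat.sInf_le hthree, hdel, hthree⟩
  rintro k ⟨E, hE, rfl, hlt⟩
  by_contra! hk
  obtain rfl | ⟨e, rfl⟩ := (Set.ncard_le_one_iff_subsingleton.1
    (Nat.le_of_lt_succ hk)).eq_empty_or_singleton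
  · simp at hlt
  · rw [hdel e (hE rfl), ceil35_eq hlow hup] at hlt
    exact lt_irrefl _ hlt

end PetersenDom
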